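/- Let N ≥ 1 be an integer, w₁, …, w_N ∈ ℂ, and let Q(z) = ∏_{j=1}^{N}(z−w_j) be the monic polynomial with these zeros. Then (1/π) ∫_ℂ exp(2U_S(z,w₁) + ⋯ + 2U_S(z,w_N)) dA_S(z) = e^N ‖Q‖_N² / ((N+1) ∏_{j=1}^{N}(1+|w_j|²)). -/

import Mathlib

open MeasureTheory

/-- The unipolar Green function of the sphere. -/
noncomputable def Usph (z w : ℂ) : ℝ :=
  1 / 2 + 1 / 2 * Real.log (‖z - w‖ ^ 2 / ((1 + ‖z‖ ^ 2) * (1 + ‖w‖ ^ 2)))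

/-- The Weyl (Bombieri) norm squared of a polynomial of degree at most `N`
with coefficients `a`. -/
noncomputable def weylNormSq (N : ℕ) (a : ℕ → ℂ) : ℝ :=
  ∑ j ∈ Finset.range (N + 1), ((N.choose j : ℝ))⁻¹ * ‖a j‖ ^ 2

/-- The spherical moment integrand `r ^ (2j+1) / (1+r²) ^ (N+2)` is integrable on the half line. -/
lemma integrableOn_radial_moment {N j : ℕ} (hj : j ≤ N) :
    IntegrableOn (fun r : ℝ => r ^ (2 * j + 1) / (1 + r ^ 2) ^ (N + 2)) (Set.Ioi 0) := by
  refine (integrable_inv_one_add_sq.integrableOn (s := Set.Ioi 0)).mono' ?_ ?_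
  · refine Continuous.aestronglyMeasurable (Continuous.div (by fun_prop) (by fun_prop) ?_)
    intro r
    positivity
  · filter_upwards [ae_restrict_mem measurableSet_Ioi] with r hr
    have hr0 : (0 : ℝ) < r := hr
    rw [Real.norm_of_nonneg (by positivity), inv_eq_one_div,
      div_le_div_iff₀ (by positivity) (by positivity)]
    have h1 : r ≤ 1 + r ^ 2 := by nlinarith [sq_nonneg (r - 1)]
    have h2 : (r ^ 2) ^ j ≤ (1 + r ^ 2) ^ N :=
      (pow_le_pow_left₀ (by positivity) (by linarith) j).trans
        (pow_le_pow_right₀ (by nlinarith) hj)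
    calc r ^ (2 * j + 1) * (1 + r ^ 2) = (r ^ 2) ^ j * r * (1 + r ^ 2) := by ring
      _ ≤ (1 + r ^ 2) ^ N * (1 + r ^ 2) * (1 + r ^ 2) := by gcongr
      _ = 1 * (1 + r ^ 2) ^ (N + 2) := by ring

lemma tendsto_pow_div_one_add_sq_pow {N j : ℕ} (hj : j ≤ N) :
    Filter.Tendsto (fun r : ℝ => r ^ (2 * j) / (1 + r ^ 2) ^ (N + 1)) Filter.atTop (nhds 0) := by
  have h0 : Filter.Tendsto (fun r : ℝ => (1 + r ^ 2)⁻¹) Filter.atTop (nhds 0) :=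
    Filter.Tendsto.inv_tendsto_atTop
      (Filter.tendsto_atTop_add_const_left _ _ (Filter.tendsto_pow_atTop two_ne_zero))
  refine squeeze_zero (fun r => ?_) (fun r => ?_) h0
  · rw [pow_mul]; positivity
  · rw [inv_eq_one_div, div_le_div_iff₀ (by positivity) (by positivity), pow_mul]
    have h2 : (r ^ 2) ^ j ≤ (1 + r ^ 2) ^ N :=
      (pow_le_pow_left₀ (by positivity) (by linarith) j).trans
        (pow_le_pow_right₀ (by nlinarith) hj)
    calc (r ^ 2) ^ j * (1 + r ^ 2) ≤ (1 + r ^ 2) ^ N * (1 + r ^ 2) := by gcongr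
      _ = 1 * (1 + r ^ 2) ^ (N + 1) := by ring

lemma hasDerivAt_pow_div_one_add_sq_pow (N m : ℕ) (r : ℝ) :
    HasDerivAt (fun r : ℝ => r ^ m / (1 + r ^ 2) ^ (N + 1))
      (m * r ^ (m - 1) / (1 + r ^ 2) ^ (N + 1) -
        2 * (N + 1) * (r ^ (m + 1) / (1 + r ^ 2) ^ (N + 2))) r := by
  have h1 : HasDerivAt (fun r : ℝ => (1 + r ^ 2) ^ (N + 1))
      (((N + 1 : ℕ) : ℝ) * (1 + r ^ 2) ^ N * (2 * r)) r := by
    simpa using ((hasDerivAt_pow 2 r).const_add 1).fun_pow (N + 1)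
  have h0 : (1 + r ^ 2 : ℝ) ≠ 0 := by positivity
  refine ((hasDerivAt_pow m r).fun_div h1 (pow_ne_zero _ h0)).congr_deriv ?_
  push_cast
  field_simp
  ring

/-- The radial moments of the spherical measure are values of the Beta function. -/
lemma integral_radial_moment (N : ℕ) {j : ℕ} (hj : j ≤ N) :
    2 * (N + 1) * (N.choose j : ℝ) *
      ∫ r in Set.Ioi (0 : ℝ), r ^ (2 * j + 1) / (1 + r ^ 2) ^ (N + 2) = 1 := by
  induction j with
  | zero =>
    have h := integral_Ioi_of_hasDerivAt_of_tendsto'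
      (fun r _ => hasDerivAt_pow_div_one_add_sq_pow N 0 r)
      (by simpa [IntegrableOn] using
        ((integrableOn_radial_moment hj).const_mul (2 * ((N : ℝ) + 1))).neg)
      (tendsto_pow_div_one_add_sq_pow hj)
    simp only [Nat.cast_zero, zero_mul, zero_div, zero_sub, integral_neg,
      integral_const_mul] at h
    norm_num at h ⊢
    linarith
  | succ j ih =>
    have ih := ih (by omega)
    have hI := integrableOn_radial_moment (N := N) (j := j) (by omega)
    have hI' := integrableOn_radial_moment hj
    have hd (r : ℝ) : HasDerivAt (fun r : ℝ => r ^ (2 * (j + 1)) / (1 + r ^ 2) ^ (N + 1))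
        (2 * (j + 1) * (r ^ (2 * j + 1) / (1 + r ^ 2) ^ (N + 2)) -
          2 * (N - j) * (r ^ (2 * (j + 1) + 1) / (1 + r ^ 2) ^ (N + 2))) r := by
      have h0 : (1 + r ^ 2 : ℝ) ≠ 0 := by positivity
      convert hasDerivAt_pow_div_one_add_sq_pow N (2 * (j + 1)) r using 1
      rw [show 2 * (j + 1) - 1 = 2 * j + 1 by omega]
      push_cast
      field_simp
      ring
    have h := integral_Ioi_of_hasDerivAt_of_tendsto' (fun r _ => hd r)
      ((hI.const_mul _).sub (hI'.const_mul _)) (tendsto_pow_div_one_add_sq_pow hj)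
    rw [integral_sub (hI.const_mul _) (hI'.const_mul _), integral_const_mul,
      integral_const_mul] at h
    have hc : (N.choose (j + 1) : ℝ) * (j + 1) = N.choose j * (N - j) := by
      have := Nat.choose_succ_right_eq N j
      rw [← Nat.cast_sub (show j ≤ N by omega)]
      exact_mod_cast this
    have hj1 : ((j : ℝ) + 1) ≠ 0 := by positivity
    simp only [ne_eq, Nat.mul_eq_zero, OfNat.ofNat_ne_zero, Nat.add_eq_zero_iff, one_ne_zero,
      and_false, or_self, not_false_eq_true, zero_pow, zero_div, sub_zero] at h
    apply mul_left_cancel₀ hj1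
    generalize (∫ r in Set.Ioi (0 : ℝ), r ^ (2 * (j + 1) + 1) / (1 + r ^ 2) ^ (N + 2)) = B at *
    generalize (∫ r in Set.Ioi (0 : ℝ), r ^ (2 * j + 1) / (1 + r ^ 2) ^ (N + 2)) = A at *
    linear_combination 2 * (N + 1) * B * hc + (j + 1) * ih - (N + 1) * N.choose j * h

lemma integral_norm_pow_div (N : ℕ) {j : ℕ} (hj : j ≤ N) :
    ∫ z : ℂ, ‖z‖ ^ (2 * j) / (1 + ‖z‖ ^ 2) ^ (N + 2) =
      Real.pi / (N + 1) * (N.choose j : ℝ)⁻¹ := by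
  have h := integral_fun_norm_addHaar (volume : Measure ℂ)
    (fun r : ℝ => r ^ (2 * j) / (1 + r ^ 2) ^ (N + 2))
  rw [h]
  have h2 := integral_radial_moment N hj
  have hc : (N.choose j : ℝ) ≠ 0 := by exact_mod_cast (Nat.choose_pos hj).ne'
  have hN : (N + 1 : ℝ) ≠ 0 := by positivity
  have hi : ∀ r : ℝ, r ^ (2 - 1) • (r ^ (2 * j) / (1 + r ^ 2) ^ (N + 2)) =
      r ^ (2 * j + 1) / (1 + r ^ 2) ^ (N + 2) := by
    intro r
    rw [smul_eq_mul]
    ring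
  simp only [Complex.finrank_real_complex, hi, Measure.real, Complex.volume_ball]
  simp only [ENNReal.ofReal_one, one_pow, one_mul, ENNReal.coe_toReal, NNReal.coe_real_pi,
    smul_eq_mul, nsmul_eq_mul, Nat.cast_ofNat]
  field_simp
  linear_combination h2

lemma integrable_monomial {N j k : ℕ} (hj : j ≤ N) (hk : k ≤ N) :
    Integrable (fun z : ℂ =>
      z ^ j * starRingEnd ℂ z ^ k / (((1 + ‖z‖ ^ 2) ^ (N + 2) : ℝ) : ℂ)) := by
  have h4 : Integrable (fun z : ℂ => ((1 : ℝ) + ‖z‖ ^ 2) ^ (-(4 : ℝ) / 2)) :=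
    integrable_rpow_neg_one_add_norm_sq (by simp; norm_num)
  refine h4.mono' ?_ (Filter.Eventually.of_forall fun z => ?_)
  · refine Continuous.aestronglyMeasurable (Continuous.div (by fun_prop) (by fun_prop) ?_)
    intro z
    exact_mod_cast (by positivity : (1 + ‖z‖ ^ 2) ^ (N + 2) ≠ (0 : ℝ))
  · have hn : ∀ m ≤ N, ‖z‖ ^ m ≤ Real.sqrt (1 + ‖z‖ ^ 2) ^ N := fun m hm =>
      (pow_le_pow_left₀ (norm_nonneg z) (Real.le_sqrt_of_sq_le (by linarith)) m).trans
        (pow_le_pow_right₀ (Real.one_le_sqrt.2 (by nlinarith [norm_nonneg z])) hm)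
    have hs : Real.sqrt (1 + ‖z‖ ^ 2) ^ N * Real.sqrt (1 + ‖z‖ ^ 2) ^ N = (1 + ‖z‖ ^ 2) ^ N := by
      rw [← mul_pow, Real.mul_self_sqrt (by positivity)]
    have hr : ((1 : ℝ) + ‖z‖ ^ 2) ^ (-(4 : ℝ) / 2) = 1 / (1 + ‖z‖ ^ 2) ^ 2 := by
      rw [show -(4 : ℝ) / 2 = -((2 : ℕ) : ℝ) by norm_num, Real.rpow_neg (by positivity),
        Real.rpow_natCast, one_div]
    rw [hr, norm_div, norm_mul, norm_pow, norm_pow, RCLike.norm_conj, Complex.norm_real,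
      Real.norm_of_nonneg (by positivity), div_le_div_iff₀ (by positivity) (by positivity)]
    calc ‖z‖ ^ j * ‖z‖ ^ k * (1 + ‖z‖ ^ 2) ^ 2
        ≤ Real.sqrt (1 + ‖z‖ ^ 2) ^ N * Real.sqrt (1 + ‖z‖ ^ 2) ^ N * (1 + ‖z‖ ^ 2) ^ 2 := by
          gcongr
          exacts [hn j hj, hn k hk]
      _ = 1 * (1 + ‖z‖ ^ 2) ^ (N + 2) := by rw [hs]; ring

lemma integral_monomial_of_ne (N : ℕ) {j k : ℕ} (hjk : j ≠ k) :
    ∫ z : ℂ, z ^ j * starRingEnd ℂ z ^ k / (((1 + ‖z‖ ^ 2) ^ (N + 2) : ℝ) : ℂ) = 0 := by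
  set c : Circle := Circle.exp (Real.pi / ((j : ℝ) - k)) with hc
  have hd : ((j : ℂ) - k) ≠ 0 := sub_ne_zero.2 (by exact_mod_cast hjk)
  have hck : (c : ℂ) ^ j * starRingEnd ℂ (c : ℂ) ^ k = -1 := by
    rw [← Complex.exp_pi_mul_I, hc, Circle.coe_exp, ← Complex.exp_conj, ← Complex.exp_nat_mul,
      ← Complex.exp_nat_mul, ← Complex.exp_add]
    congr 1
    simp only [map_mul, Complex.conj_I, Complex.conj_ofReal]
    push_cast
    field_simp
    ring
  have h := (rotation c).measurePreserving.integral_comp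
    (rotation c).toHomeomorph.measurableEmbedding
    (fun z : ℂ => z ^ j * starRingEnd ℂ z ^ k / (((1 + ‖z‖ ^ 2) ^ (N + 2) : ℝ) : ℂ))
  have he : ∀ z : ℂ, (rotation c z) ^ j * starRingEnd ℂ (rotation c z) ^ k /
      (((1 + ‖rotation c z‖ ^ 2) ^ (N + 2) : ℝ) : ℂ) =
      -(z ^ j * starRingEnd ℂ z ^ k / (((1 + ‖z‖ ^ 2) ^ (N + 2) : ℝ) : ℂ)) := by
    intro z
    rw [LinearIsometryEquiv.norm_map, rotation_apply, map_mul, mul_pow, mul_pow,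
      mul_mul_mul_comm, hck, neg_one_mul, neg_div]
  simp only [he, integral_neg] at h
  exact self_eq_neg.1 h.symm

lemma integral_monomial_self (N : ℕ) {j : ℕ} (hj : j ≤ N) :
    ∫ z : ℂ, z ^ j * starRingEnd ℂ z ^ j / (((1 + ‖z‖ ^ 2) ^ (N + 2) : ℝ) : ℂ) =
      ((Real.pi / (N + 1) * (N.choose j : ℝ)⁻¹ : ℝ) : ℂ) := by
  rw [← integral_norm_pow_div N hj, ← integral_complex_ofReal]
  refine integral_congr_ae (Filter.Eventually.of_forall fun z => ?_)
  simp only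
  rw [← mul_pow, Complex.mul_conj, Complex.normSq_eq_norm_sq, pow_mul]
  push_cast
  rfl

/-- The Weyl norm is, up to a constant, the `L²` norm for the density `(1 + |z|²) ^ (-(N+2))`. -/
lemma integral_normSq_sum_eq_weylNormSq (N : ℕ) (a : ℕ → ℂ) :
    ∫ z : ℂ, ‖∑ j ∈ Finset.range (N + 1), a j * z ^ j‖ ^ 2 / (1 + ‖z‖ ^ 2) ^ (N + 2) =
      Real.pi / (N + 1) * weylNormSq N a := by
  have hle {i : ℕ} (hi : i ∈ Finset.range (N + 1)) : i ≤ N :=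
    Nat.lt_succ_iff.1 (Finset.mem_range.1 hi)
  have hint {j k : ℕ} (hj : j ∈ Finset.range (N + 1)) (hk : k ∈ Finset.range (N + 1)) :=
    (integrable_monomial (hle hj) (hle hk)).const_mul (a j * starRingEnd ℂ (a k))
  have key : ∀ z : ℂ,
      ((‖∑ j ∈ Finset.range (N + 1), a j * z ^ j‖ ^ 2 / (1 + ‖z‖ ^ 2) ^ (N + 2) : ℝ) : ℂ) =
      ∑ j ∈ Finset.range (N + 1), ∑ k ∈ Finset.range (N + 1), a j * starRingEnd ℂ (a k) *
        (z ^ j * starRingEnd ℂ z ^ k / (((1 + ‖z‖ ^ 2) ^ (N + 2) : ℝ) : ℂ)) := by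
    intro z
    rw [Complex.ofReal_div, ← Complex.normSq_eq_norm_sq, ← Complex.mul_conj, map_sum,
      Finset.sum_mul_sum, Finset.sum_div]
    refine Finset.sum_congr rfl fun j _ => ?_
    rw [Finset.sum_div]
    refine Finset.sum_congr rfl fun k _ => ?_
    rw [map_mul, map_pow]
    ring
  apply Complex.ofReal_injective
  rw [← integral_complex_ofReal]
  simp only [key]
  rw [integral_finsetSum _ fun j hj => integrable_finsetSum _ fun k hk => hint hj hk,
    weylNormSq, Finset.mul_sum, Complex.ofReal_sum]
  refine Finset.sum_congr rfl fun j hj => ?_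
  rw [integral_finsetSum _ fun k hk => hint hj hk, Finset.sum_eq_single_of_mem j hj]
  · rw [integral_const_mul, integral_monomial_self N (hle hj), Complex.mul_conj,
      Complex.normSq_eq_norm_sq, ← Complex.ofReal_mul]
    congr 1
    ring
  · intro k _ hkj
    rw [integral_const_mul, integral_monomial_of_ne N hkj.symm, mul_zero]

lemma exp_two_mul_Usph {z w : ℂ} (h : z ≠ w) :
    Real.exp (2 * Usph z w) =
      Real.exp 1 * (‖z - w‖ ^ 2 / ((1 + ‖z‖ ^ 2) * (1 + ‖w‖ ^ 2))) := by
  have h0 : 0 < ‖z - w‖ := norm_pos_iff.2 (sub_ne_zero.2 h)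
  rw [Usph, show ∀ x : ℝ, 2 * (1 / 2 + 1 / 2 * x) = 1 + x by intro x; ring, Real.exp_add,
    Real.exp_log (by positivity)]

/-- integral of `exp(2 Σ U_S(z, w_j))` in terms of the Weyl norm of
the monic polynomial with zeros `w₁, …, w_N`. -/
theorem Usph_exp_sum_eq_weyl (N : ℕ) (hN : 1 ≤ N) (w : Fin N → ℂ) :
    1 / Real.pi *
        ∫ z : ℂ, Real.exp (∑ j, 2 * Usph z (w j)) * (1 / (1 + ‖z‖ ^ 2) ^ 2) =
      Real.exp N *
          weylNormSq N (fun k => (∏ j, (Polynomial.X - Polynomial.C (w j))).coeff k) /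
        ((N + 1) * ∏ j, (1 + ‖w j‖ ^ 2)) := by
  set Q : Polynomial ℂ := ∏ j, (Polynomial.X - Polynomial.C (w j)) with hQ
  have hdeg : Q.natDegree = N := by
    simp [hQ]
  have hae : (fun z : ℂ => Real.exp (∑ j, 2 * Usph z (w j)) * (1 / (1 + ‖z‖ ^ 2) ^ 2)) =ᵐ[volume]
      fun z => Real.exp N / (∏ j, (1 + ‖w j‖ ^ 2)) *
        (‖∑ j ∈ Finset.range (N + 1), Q.coeff j * z ^ j‖ ^ 2 / (1 + ‖z‖ ^ 2) ^ (N + 2)) := by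
    have hfin : ∀ᵐ z : ℂ, z ∉ Set.range w :=
      measure_eq_zero_iff_ae_notMem.1 ((Set.finite_range w).measure_zero _)
    filter_upwards [hfin] with z hz
    have hzw : ∀ j, z ≠ w j := fun j h => hz ⟨j, h.symm⟩
    have heval : ∑ j ∈ Finset.range (N + 1), Q.coeff j * z ^ j = ∏ j, (z - w j) := by
      rw [← Polynomial.eval_eq_sum_range' (by omega), hQ, Polynomial.eval_prod]
      simp
    rw [heval, Real.exp_sum, Finset.prod_congr rfl fun j _ => exp_two_mul_Usph (hzw j)]
    simp only [Finset.prod_mul_distrib, Finset.prod_div_distrib, Finset.prod_const,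
      Finset.card_univ, Fintype.card_fin, norm_prod, Finset.prod_pow, ← Real.exp_nat_mul, mul_one]
    have : (∏ j, (1 + ‖w j‖ ^ 2)) ≠ 0 := Finset.prod_ne_zero_iff.2 fun j _ => by positivity
    field_simp
    ring
  rw [integral_congr_ae hae, integral_const_mul, integral_normSq_sum_eq_weylNormSq]
  have hpi := Real.pi_ne_zero
  field_simp
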